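/- arXiv:1802.01165 — 2 statements merged into one kernel-verified Lean document; each statement's English description precedes it below -/
import Mathlib

section
/- Let S be a set and I : S → S → ℝ a symmetric function with I x y > 0 for all x, y ∈ S. For L ∈ S and distinct A, B ∈ S \ {L} set u_L(A,B) := I L A * I L B / I A B, and u_L(A,A) := 0. Let F be a subset of S. If for some L ∈ F the function u_L is an ultrametric on F \ {L}, then for every M ∈ F the function u_M is an ultrametric on F \ {M}. -/
open Classical in
/-- The function `u_L` attached to a pairing `I` and a base point `L`:
`u_L(A,B) := I L A · I L B / I A B` for `A ≠ B`, and `u_L(A,A) := 0`. -/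
noncomputable def uFun {S : Type*} (I : S → S → ℝ) (L A B : S) : ℝ :=
  if A = B then 0 else I L A * I L B / I A B

/-- `u` is an ultrametric on the subset `T`: it is symmetric, vanishes exactly on
the diagonal, and satisfies the ultrametric inequality. -/
def IsUltrametricOn {S : Type*} (u : S → S → ℝ) (T : Set S) : Prop :=
  (∀ a ∈ T, ∀ b ∈ T, u a b = u b a) ∧
  (∀ a ∈ T, ∀ b ∈ T, (u a b = 0 ↔ a = b)) ∧
  (∀ a ∈ T, ∀ b ∈ T, ∀ c ∈ T, u a b ≤ max (u a c) (u c b))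

/-- The four-point inequality satisfied by the six pairwise distances
`a = d(A,B)`, `b = d(A,C)`, `c = d(C,B)`, `d = d(M,A)`, `e = d(M,B)`, `f = d(M,C)`
of an ultrametric space, in multiplicative form. -/
theorem ultrametric_four_point {a b c d e f : ℝ} (ha : 0 < a) (hf : 0 < f)
    (habc : a ≤ b ∨ a ≤ c) (hade : a ≤ d ∨ a ≤ e) (hfbd : f ≤ b ∨ f ≤ d) (hfce : f ≤ c ∨ f ≤ e) :
    a * f ≤ b * e ∨ a * f ≤ c * d := by
  have key {x y z w : ℝ} (hx : 0 < x) (hy : 0 < y) (hxz : x ≤ z) (hyw : y ≤ w) :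
      x * y ≤ z * w := mul_le_mul hxz hyw hy.le (hx.le.trans hxz)
  by_contra! hlt
  have hbe : ¬ (a ≤ b ∧ f ≤ e) := fun h => (key ha hf h.1 h.2).not_gt hlt.1
  have hbe' : ¬ (a ≤ e ∧ f ≤ b) := fun h => by
    linarith [key ha hf h.1 h.2, mul_comm b e]
  have hcd : ¬ (a ≤ c ∧ f ≤ d) := fun h => (key ha hf h.1 h.2).not_gt hlt.2
  have hcd' : ¬ (a ≤ d ∧ f ≤ c) := fun h => by
    linarith [key ha hf h.1 h.2, mul_comm c d]
  grind

theorem mul_div_le_mul_div_iff {x y z p q : ℝ} (hx : 0 < x) (hp : 0 < p) (hq : 0 < q) :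
    x * y / p ≤ x * z / q ↔ q * y ≤ p * z := by
  rw [div_le_div_iff₀ hp hq, mul_assoc, mul_assoc, mul_le_mul_iff_right₀ hx, mul_comm y,
    mul_comm z]

theorem isUltrametricOn_uFun_iff {S : Type*} {I : S → S → ℝ}
    (hsym : ∀ x y : S, I x y = I y x) (hpos : ∀ x y : S, 0 < I x y) (L : S) (T : Set S) :
    IsUltrametricOn (uFun I L) T ↔
      ∀ a ∈ T, ∀ b ∈ T, ∀ c ∈ T, a ≠ b → a ≠ c → c ≠ b →
        I a c * I L b ≤ I a b * I L c ∨ I c b * I L a ≤ I a b * I L c := by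
  have huFun {a b : S} (h : a ≠ b) : uFun I L a b = I L a * I L b / I a b := if_neg h
  have hself (a : S) : uFun I L a a = 0 := if_pos rfl
  have hu_pos {a b : S} (h : a ≠ b) : 0 < uFun I L a b := by
    rw [huFun h]
    exact div_pos (mul_pos (hpos _ _) (hpos _ _)) (hpos _ _)
  have hiff {a b c : S} (hab : a ≠ b) (hac : a ≠ c) (hcb : c ≠ b) :
      uFun I L a b ≤ max (uFun I L a c) (uFun I L c b) ↔
        I a c * I L b ≤ I a b * I L c ∨ I c b * I L a ≤ I a b * I L c := by
    rw [le_max_iff, huFun hab, huFun hac, huFun hcb,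
      mul_div_le_mul_div_iff (hpos _ _) (hpos _ _) (hpos _ _), mul_comm (I L a) (I L b),
      mul_comm (I L c) (I L b), mul_div_le_mul_div_iff (hpos _ _) (hpos _ _) (hpos _ _)]
  refine ⟨fun h a ha b hb c hc hab hac hcb => (hiff hab hac hcb).1 (h.2.2 a ha b hb c hc),
    fun h => ⟨fun a _ b _ => ?_, fun a _ b _ => ?_, fun a ha b hb c hc => ?_⟩⟩
  · rcases eq_or_ne a b with rfl | hab
    · rfl
    · rw [huFun hab, huFun hab.symm, mul_comm, hsym a b]
  · refine ⟨fun h₀ => ?_, fun hab => hab ▸ hself a⟩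
    by_contra hab
    exact (hu_pos hab).ne' h₀
  · rcases eq_or_ne a c with rfl | hac
    · exact le_max_right _ _
    rcases eq_or_ne c b with rfl | hcb
    · exact le_max_left _ _
    rcases eq_or_ne a b with rfl | hab
    · rw [hself]
      exact le_max_of_le_left (hu_pos hac).le
    · exact (hiff hab hac hcb).2 (h a ha b hb c hc hab hac hcb)

/-- **Independence of the base point.**  Let `I` be a symmetric positive pairing on
`S` (the intersection number of branches in the paper) and `F ⊆ S`.  If `u_L` is an
ultrametric on `F \ {L}` for one `L ∈ F`, then `u_M` is an ultrametric on `F \ {M}`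
for every `M ∈ F`. -/
theorem ultrametric_indep_of_base_point
    {S : Type*} (I : S → S → ℝ)
    (hsym : ∀ x y : S, I x y = I y x) (hpos : ∀ x y : S, 0 < I x y)
    (F : Set S) (L : S) (hL : L ∈ F)
    (hult : IsUltrametricOn (uFun I L) (F \ {L})) :
    ∀ M ∈ F, IsUltrametricOn (uFun I M) (F \ {M}) := by
  intro M hM
  rcases eq_or_ne M L with rfl | hML
  · exact hult
  rw [isUltrametricOn_uFun_iff hsym hpos] at hult ⊢
  rintro a ⟨ha, haM : a ≠ M⟩ b ⟨hb, hbM : b ≠ M⟩ c ⟨hc, hcM : c ≠ M⟩ hab hac hcb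
  rcases eq_or_ne a L with rfl | haL
  · have := hult M ⟨hM, hML⟩ c ⟨hc, hac.symm⟩ b ⟨hb, hab.symm⟩ hcM.symm hbM.symm hcb.symm
    grind
  rcases eq_or_ne b L with rfl | hbL
  · have := hult M ⟨hM, hML⟩ c ⟨hc, hcb⟩ a ⟨ha, hab⟩ hcM.symm haM.symm hac
    grind
  rcases eq_or_ne c L with rfl | hcL
  · have := hult a ⟨ha, hac⟩ b ⟨hb, hcb.symm⟩ M ⟨hM, hML⟩ hab haM hbM.symm
    rw [hsym a c, hsym M a, hsym M c, mul_comm (I c a), mul_comm (I c b)]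
    exact this.symm
  have hv_pos (x y : S) : 0 < I L x * I L y / I x y :=
    div_pos (mul_pos (hpos _ _) (hpos _ _)) (hpos _ _)
  have hv {x y z : S} (hx : x ∈ F \ {L}) (hy : y ∈ F \ {L}) (hz : z ∈ F \ {L})
      (hxy : x ≠ y) (hxz : x ≠ z) (hzy : z ≠ y) :
      I L x * I L y / I x y ≤ I L x * I L z / I x z ∨
        I L x * I L y / I x y ≤ I L z * I L y / I z y := by
    rw [mul_div_le_mul_div_iff (hpos _ _) (hpos _ _) (hpos _ _), mul_comm (I L x) (I L y),
      mul_comm (I L z) (I L y), mul_div_le_mul_div_iff (hpos _ _) (hpos _ _) (hpos _ _)]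
    exact hult x hx y hy z hz hxy hxz hzy
  have hcomm (x y : S) : I L x * I L y / I x y = I L y * I L x / I y x := by
    rw [mul_comm (I L x), hsym x y]
  have hA : a ∈ F \ {L} := ⟨ha, haL⟩
  have hB : b ∈ F \ {L} := ⟨hb, hbL⟩
  have hC : c ∈ F \ {L} := ⟨hc, hcL⟩
  have hM' : M ∈ F \ {L} := ⟨hM, hML⟩
  have h := ultrametric_four_point (hv_pos a b) (hv_pos M c)
    (hv hA hB hC hab hac hcb)
    (hcomm a M ▸ hv hA hB hM' hab haM hbM.symm)
    (hv hM' hC hA hcM.symm haM.symm hac).symm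
    (hcomm b c ▸ hv hM' hC hB hcM.symm hbM.symm hcb.symm).symm
  have hL_pos : 0 < I L a * I L b * I L c * I L M :=
    mul_pos (mul_pos (mul_pos (hpos _ _) (hpos _ _)) (hpos _ _)) (hpos _ _)
  have hprod {p q r s : ℝ} (hpq : 0 < p * q) (hrs : 0 < r * s) :
      I L a * I L b * I L c * I L M / (p * q) ≤ I L a * I L b * I L c * I L M / (r * s) ↔
        r * s ≤ p * q := div_le_div_iff_of_pos_left hL_pos hpq hrs
  have hpp (x y z w : S) : 0 < I x y * I z w := mul_pos (hpos _ _) (hpos _ _)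
  rw [← hprod (hpp a b M c) (hpp a c M b), ← hprod (hpp a b M c) (hpp c b M a)]
  simp only [div_mul_div_comm] at h
  convert h using 3 <;> ring
end

section
/- Let Γ be a finite connected graph (loops and multiple edges allowed) and let a, b, c be three not necessarily pairwise distinct vertices of Γ. Then a separates b from c in Γ if and only if ā separates b̄ from c̄ in the brick-vertex tree BV(Γ). -/
/-! ## Multigraphs

A graph in the sense of the paper is a finite 1-dimensional cell complex: finitely
many vertices and edges, with loops and multiple edges allowed.  We record it as a
map assigning to each edge its unordered pair of endpoints. -/

/-- A multigraph on vertex type `V` with edge-index type `E`: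
loops and multiple edges are allowed. -/
structure Multigraph (V : Type) (E : Type) where
  /-- The unordered pair of endpoints of an edge. -/
  ends : E → Sym2 V

namespace Multigraph

variable {V E : Type}

/-- Walks in a multigraph: compatible sequences of edges. -/
inductive Walk (G : Multigraph V E) : V → V → Type
  | nil (v : V) : Walk G v v
  | cons {u v w : V} (e : E) (h : G.ends e = s(u, v)) (p : Walk G v w) : Walk G u w

namespace Walk

variable {G : Multigraph V E}

/-- The list of vertices visited by a walk, in order. -/
def support : {u w : V} → G.Walk u w → List V
  | _, _, .nil v => [v]
  | u, _, .cons _ _ p => u :: p.support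

/-- The list of edges used by a walk, in order. -/
def edges : {u w : V} → G.Walk u w → List E
  | _, _, .nil _ => []
  | _, _, .cons e _ p => e :: p.edges

/-- A closed walk is a circuit if it uses at least one edge, repeats no edge, and
repeats no vertex except its endpoints; the circuits are exactly the unions of
edges whose underlying topological space is homeomorphic to a circle. -/
def IsCircuit {v : V} (p : G.Walk v v) : Prop :=
  p.edges ≠ [] ∧ p.edges.Nodup ∧ p.support.tail.Nodup

end Walk

/-- A multigraph is connected if it has a vertex and any two vertices are joined
by a walk. -/
def Connected (G : Multigraph V E) : Prop :=
  Nonempty V ∧ ∀ u v : V, Nonempty (G.Walk u v)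

/-- The vertex `v` separates `a` and `b` in `G`: every walk from `a` to `b` passes
through `v`.  (Equivalently: either `v ∈ {a, b}`, or `a` and `b` lie in distinct
connected components of the space obtained from `G` by removing `v`.) -/
def Separates (G : Multigraph V E) (v a b : V) : Prop :=
  ∀ p : G.Walk a b, v ∈ p.support

/-- A tree: a connected graph containing no circuit. -/
def IsTree (G : Multigraph V E) : Prop :=
  G.Connected ∧ ∀ (v : V) (p : G.Walk v v), ¬ p.IsCircuit

/-- The edge `e` lies on some circuit of `G`. -/
def InCircuit (G : Multigraph V E) (e : E) : Prop :=
  ∃ (v : V) (p : G.Walk v v), p.IsCircuit ∧ e ∈ p.edges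

/-- Two edges are related when they are equal or lie on a common circuit.  The
equivalence classes of this relation are the edge sets of the blocks (the maximal
nonseparable subgraphs) of a connected graph. -/
def EdgeRel (G : Multigraph V E) (e f : E) : Prop :=
  e = f ∨ ∃ (v : V) (p : G.Walk v v), p.IsCircuit ∧ e ∈ p.edges ∧ f ∈ p.edges

/-- A brick of `G`, recorded by its set of edges: a brick is a block (a maximal
nonseparable subgraph) which is not a bridge, i.e. the class, for the relation
`EdgeRel`, of an edge lying on a circuit. -/
def IsBrick (G : Multigraph V E) (C : Set E) : Prop :=
  ∃ e, G.InCircuit e ∧ C = {f | G.EdgeRel e f}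

/-- A bridge of `G`: a block consisting of a single edge, i.e. an edge lying on no
circuit. -/
def IsBridge (G : Multigraph V E) (e : E) : Prop :=
  ¬ G.InCircuit e

/-- The vertices of the brick with edge set `C`. -/
def brickVerts (G : Multigraph V E) (C : Set E) : Set V :=
  {a | ∃ e ∈ C, a ∈ G.ends e}

/-- Vertices of the brick-vertex tree: the vertices of `G` together with one new
vertex for each brick of `G`. -/
abbrev BVVert (G : Multigraph V E) : Type :=
  V ⊕ {C : Set E // G.IsBrick C}

/-- Edges of the brick-vertex tree: the bridges of `G`, together with one new edge
for each incident pair (vertex `a`, brick `B`) with `a` a vertex of `B`. -/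
abbrev BVEdge (G : Multigraph V E) : Type :=
  {e : E // G.IsBridge e} ⊕
    {p : V × {C : Set E // G.IsBrick C} // p.1 ∈ G.brickVerts p.2.val}

/-- The brick-vertex tree of `G`: a bridge of `G` keeps its endpoints, and the new
edge attached to an incident pair (vertex, brick) joins the corresponding vertices. -/
def bvt (G : Multigraph V E) : Multigraph (BVVert G) (BVEdge G) where
  ends := fun e =>
    match e with
    | Sum.inl e => (G.ends e.val).map Sum.inl
    | Sum.inr pr => s(Sum.inl pr.val.1, Sum.inr pr.val.2)

/-- The valency of the vertex `x` with respect to a set `S` of edges of `G`: the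
number of germs of edges of `S` adjacent to `x`, a loop counting twice. -/
noncomputable def valency (G : Multigraph V E) (S : Set E) (x : V) : ℕ :=
  Nat.card {e : E // e ∈ S ∧ x ∈ G.ends e ∧ ¬ (G.ends e).IsDiag} +
    2 * Nat.card {e : E // e ∈ S ∧ G.ends e = s(x, x)}

end Multigraph

namespace Multigraph

variable {V E : Type} {G : Multigraph V E}

namespace Walk

theorem start_mem_support {u w : V} (p : G.Walk u w) : u ∈ p.support := by
  cases p <;> simp [support]

theorem end_mem_support {u w : V} (p : G.Walk u w) : w ∈ p.support := by
  induction p with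
  | nil v => simp [support]
  | cons e h p ih => simp [support, ih]

theorem mem_support_of_mem_edges {u w x : V} {e : E} (p : G.Walk u w) (he : e ∈ p.edges)
    (hx : x ∈ G.ends e) : x ∈ p.support := by
  induction p with
  | nil v => simp [edges] at he
  | cons f h p ih =>
    simp only [edges, List.mem_cons] at he
    simp only [support, List.mem_cons]
    rcases he with rfl | he
    · rw [h, Sym2.mem_iff] at hx
      rcases hx with rfl | rfl
      · exact Or.inl rfl
      · exact Or.inr p.start_mem_support
    · exact Or.inr (ih he)

theorem not_nodup_support_of_loop_mem_edges {u w x : V} {e : E} (p : G.Walk u w)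
    (he : e ∈ p.edges) (hx : G.ends e = s(x, x)) : ¬ p.support.Nodup := by
  induction p with
  | nil v => simp [edges] at he
  | cons f h p ih =>
    simp only [edges, List.mem_cons] at he
    simp only [support, List.nodup_cons, not_and]
    intro hu
    rcases he with rfl | he
    · have := p.start_mem_support
      rw [hx] at h
      simp only [Sym2.eq_iff, and_comm, or_self] at h
      obtain ⟨rfl, rfl⟩ := h
      exact absurd this hu
    · exact ih he

theorem IsCircuit.eq_of_loop_mem_edges {v x y : V} {e : E} {p : G.Walk v v} (hp : p.IsCircuit)
    (he : e ∈ p.edges) (hx : G.ends e = s(x, x)) (hy : y ∈ p.support) : y = x := by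
  obtain ⟨-, -, hn⟩ := hp
  cases p with
  | nil => simp [edges] at he
  | cons f h q =>
    simp only [support, List.tail_cons] at hn
    simp only [edges, List.mem_cons] at he
    rcases he with rfl | he
    · rw [hx] at h
      simp only [Sym2.eq_iff, and_comm, or_self] at h
      obtain ⟨rfl, rfl⟩ := h
      cases q with
      | nil => simpa [support] using hy
      | cons f h q =>
        simp only [support, List.nodup_cons] at hn
        exact absurd q.end_mem_support hn.1
    · exact absurd hn (q.not_nodup_support_of_loop_mem_edges he hx)

end Walk

theorem not_separates_iff {a u w : V} :
    ¬ G.Separates a u w ↔ ∃ p : G.Walk u w, a ∉ p.support := by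
  simp [Separates]

theorem not_separates_refl {a u : V} (h : u ≠ a) : ¬ G.Separates a u u :=
  not_separates_iff.2 ⟨.nil u, by simpa [Walk.support] using h.symm⟩

theorem not_separates_cons {a u v w : V} {e : E} (he : G.ends e = s(u, v)) (hu : u ≠ a)
    (h : ¬ G.Separates a v w) : ¬ G.Separates a u w := by
  obtain ⟨p, hp⟩ := not_separates_iff.1 h
  exact not_separates_iff.2 ⟨.cons e he p, by simpa [Walk.support] using ⟨hu.symm, hp⟩⟩

theorem not_separates_trans {a u v w : V} (h₁ : ¬ G.Separates a u v)
    (h₂ : ¬ G.Separates a v w) : ¬ G.Separates a u w := by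
  obtain ⟨p, hp⟩ := not_separates_iff.1 h₁
  induction p with
  | nil => exact h₂
  | cons e he p ih =>
    simp only [Walk.support, List.mem_cons, not_or] at hp
    exact not_separates_cons he (Ne.symm hp.1) (ih (not_separates_iff.2 ⟨p, hp.2⟩) h₂ hp.2)

theorem ne_left_of_not_separates {a u w : V} (h : ¬ G.Separates a u w) : u ≠ a := by
  rintro rfl
  exact h fun p => p.start_mem_support

theorem ne_right_of_not_separates {a u w : V} (h : ¬ G.Separates a u w) : w ≠ a := by
  rintro rfl
  exact h fun p => p.end_mem_support

theorem not_separates_symm {a u w : V} (h : ¬ G.Separates a u w) : ¬ G.Separates a w u := by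
  obtain ⟨p, hp⟩ := not_separates_iff.1 h
  induction p with
  | nil => exact h
  | cons e he p ih =>
    simp only [Walk.support, List.mem_cons, not_or] at hp
    have hp' := not_separates_iff.2 ⟨p, hp.2⟩
    exact not_separates_trans (ih hp' hp.2)
      (not_separates_cons (he.trans Sym2.eq_swap) (ne_left_of_not_separates hp')
        (not_separates_refl (Ne.symm hp.1)))

theorem Walk.not_separates_end {a u x y : V} (p : G.Walk x y) (ha : a ∉ p.support)
    (hu : u ∈ p.support) : ¬ G.Separates a u y := by
  induction p with
  | nil v =>
    simp only [support, List.mem_singleton] at hu ha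
    subst hu
    exact not_separates_refl (Ne.symm ha)
  | cons e he p ih =>
    simp only [support, List.mem_cons] at hu
    rcases hu with rfl | hu
    · exact not_separates_iff.2 ⟨_, ha⟩
    · exact ih (fun h => ha (by simp [support, h])) hu

theorem Walk.not_separates_start_or_end {a u x y : V} (p : G.Walk x y) (hn : p.support.Nodup)
    (hu : u ∈ p.support) (hua : u ≠ a) : ¬ G.Separates a x u ∨ ¬ G.Separates a u y := by
  induction p with
  | nil v =>
    simp only [support, List.mem_singleton] at hu
    subst hu
    exact Or.inl (not_separates_refl hua)
  | @cons x z w e he p ih =>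
    simp only [support, List.mem_cons, List.nodup_cons] at hu hn
    rcases hu with rfl | hu
    · exact Or.inl (not_separates_refl hua)
    · by_cases hx : x = a
      · subst hx
        exact Or.inr (p.not_separates_end hn.1 hu)
      · exact (ih hn.2 hu).imp_left (not_separates_cons he hx)

/-- A circuit stays connected when one vertex is removed. -/
theorem Walk.IsCircuit.not_separates {a v u w : V} {p : G.Walk v v} (hp : p.IsCircuit)
    (hu : u ∈ p.support) (hw : w ∈ p.support) (hua : u ≠ a) (hwa : w ≠ a) :
    ¬ G.Separates a u w := by
  obtain ⟨h0, -, hn⟩ := hp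
  cases p with
  | nil => simp [edges] at h0
  | @cons _ z _ e he q =>
    simp only [support, List.tail_cons] at hn
    have mem {t : V} (ht : t ∈ (Walk.cons e he q).support) : t ∈ q.support := by
      simp only [support, List.mem_cons] at ht
      rcases ht with rfl | ht
      · exact q.end_mem_support
      · exact ht
    have across (hv : v ≠ a) (hz : z ≠ a) : ¬ G.Separates a v z :=
      not_separates_cons he hv (not_separates_refl hz)
    rcases q.not_separates_start_or_end hn (mem hu) hua with h₁ | h₁ <;>
      rcases q.not_separates_start_or_end hn (mem hw) hwa with h₂ | h₂
    · exact not_separates_trans (not_separates_symm h₁) h₂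
    · exact not_separates_trans (not_separates_symm h₁) (not_separates_trans
        (not_separates_symm (across (ne_right_of_not_separates h₂) (ne_left_of_not_separates h₁)))
        (not_separates_symm h₂))
    · exact not_separates_trans h₁ (not_separates_trans
        (across (ne_right_of_not_separates h₁) (ne_left_of_not_separates h₂)) h₂)
    · exact not_separates_trans h₁ (not_separates_symm h₂)

theorem InCircuit.exists_circuit_of_edgeRel {e f : E} (he : G.InCircuit e) (h : G.EdgeRel e f) :
    ∃ (v : V) (p : G.Walk v v), p.IsCircuit ∧ e ∈ p.edges ∧ f ∈ p.edges := by
  rcases h with rfl | h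
  · obtain ⟨v, p, hp, hpe⟩ := he
    exact ⟨v, p, hp, hpe, hpe⟩
  · exact h

/-- A brick stays connected when one vertex is removed. -/
theorem IsBrick.not_separates {C : Set E} (hC : G.IsBrick C) {a u w : V}
    (hu : u ∈ G.brickVerts C) (hw : w ∈ G.brickVerts C) (hua : u ≠ a) (hwa : w ≠ a) :
    ¬ G.Separates a u w := by
  obtain ⟨e, he, rfl⟩ := hC
  obtain ⟨f, hf, huf⟩ := hu
  obtain ⟨g, hg, hwg⟩ := hw
  obtain ⟨v₁, p₁, hp₁, he₁, hf₁⟩ := he.exists_circuit_of_edgeRel hf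
  obtain ⟨v₂, p₂, hp₂, he₂, hg₂⟩ := he.exists_circuit_of_edgeRel hg
  have hup := p₁.mem_support_of_mem_edges hf₁ huf
  have hwp := p₂.mem_support_of_mem_edges hg₂ hwg
  have hx : ∃ x ∈ G.ends e, x ≠ a := by
    by_contra! hall
    refine hua (hp₁.eq_of_loop_mem_edges he₁ ?_ hup)
    generalize G.ends e = z at hall
    induction z with
    | _ x y => rw [hall x (Sym2.mem_mk_left x y), hall y (Sym2.mem_mk_right x y)]
  obtain ⟨x, hx, hxa⟩ := hx
  exact not_separates_trans
    (hp₁.not_separates hup (p₁.mem_support_of_mem_edges he₁ hx) hua hxa)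
    (hp₂.not_separates (p₂.mem_support_of_mem_edges he₂ hx) hwp hxa hwa)

theorem InCircuit.isBrick {e : E} (he : G.InCircuit e) : G.IsBrick {f | G.EdgeRel e f} :=
  ⟨e, he, rfl⟩

theorem not_separates_bvt_of_edge {a u v : V} {e : E} (he : G.ends e = s(u, v)) (hu : u ≠ a)
    (hv : v ≠ a) : ¬ G.bvt.Separates (Sum.inl a) (Sum.inl u) (Sum.inl v) := by
  have hu' : (Sum.inl u : BVVert G) ≠ Sum.inl a := by simpa using hu
  have hv' : (Sum.inl v : BVVert G) ≠ Sum.inl a := by simpa using hv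
  by_cases hc : G.InCircuit e
  · have mem {x : V} (hx : x ∈ G.ends e) : x ∈ G.brickVerts {f | G.EdgeRel e f} :=
      ⟨e, Or.inl rfl, hx⟩
    have mu := mem (he ▸ Sym2.mem_mk_left u v)
    have mv := mem (he ▸ Sym2.mem_mk_right u v)
    exact not_separates_cons (G := G.bvt) (v := Sum.inr ⟨_, hc.isBrick⟩)
      (e := Sum.inr ⟨(u, ⟨_, hc.isBrick⟩), mu⟩) rfl hu'
      (not_separates_cons (G := G.bvt) (e := Sum.inr ⟨(v, ⟨_, hc.isBrick⟩), mv⟩)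
        Sym2.eq_swap Sum.inr_ne_inl (not_separates_refl hv'))
  · refine not_separates_cons (G := G.bvt) (e := Sum.inl ⟨e, hc⟩) ?_ hu' (not_separates_refl hv')
    simp [bvt, he]

theorem not_separates_bvt {a b c : V} (h : ¬ G.Separates a b c) :
    ¬ G.bvt.Separates (Sum.inl a) (Sum.inl b) (Sum.inl c) := by
  obtain ⟨p, hp⟩ := not_separates_iff.1 h
  induction p with
  | nil v =>
    exact not_separates_refl (by simpa using ne_left_of_not_separates h)
  | cons e he p ih =>
    simp only [Walk.support, List.mem_cons, not_or] at hp
    have hp' := not_separates_iff.2 ⟨p, hp.2⟩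
    exact not_separates_trans
      (not_separates_bvt_of_edge he (Ne.symm hp.1) (ne_left_of_not_separates hp')) (ih hp' hp.2)

theorem not_separates_of_bvt_walk {a c : V} {X Y : BVVert G} (p : G.bvt.Walk X Y)
    (hY : Y = Sum.inl c) (hp : Sum.inl a ∉ p.support) :
    (∀ u, X = Sum.inl u → ¬ G.Separates a u c) ∧
      ∀ B, X = Sum.inr B → ∀ u ∈ G.brickVerts B.val, u ≠ a → ¬ G.Separates a u c := by
  induction p with
  | nil v =>
    subst hY
    simp only [Walk.support, List.mem_singleton, Sum.inl.injEq] at hp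
    refine ⟨fun u hu => ?_, fun B hB => by simp at hB⟩
    obtain rfl := Sum.inl.inj hu
    exact not_separates_refl (Ne.symm hp)
  | @cons X Z Y e he p ih =>
    simp only [Walk.support, List.mem_cons, not_or] at hp
    obtain ⟨ih₁, ih₂⟩ := ih hY hp.2
    rcases e with ⟨e, hb⟩ | ⟨⟨v, B⟩, hv⟩
    · rcases hz : G.ends e with ⟨x, y⟩
      replace hz : G.ends e = s(x, y) := hz
      simp only [bvt, hz, Sym2.map_mk, Sym2.eq_iff] at he
      refine ⟨fun u hu => ?_, fun B hB => ?_⟩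
      · subst hu
        rcases he with ⟨h₁, h₂⟩ | ⟨h₁, h₂⟩
        · obtain rfl := Sum.inl.inj h₁
          exact not_separates_cons hz (fun h => hp.1 (by rw [h])) (ih₁ y h₂.symm)
        · obtain rfl := Sum.inl.inj h₂
          exact not_separates_cons (hz.trans Sym2.eq_swap) (fun h => hp.1 (by rw [h]))
            (ih₁ x h₁.symm)
      · subst hB
        simp at he
    · simp only [bvt, Sym2.eq_iff] at he
      rcases he with ⟨rfl, rfl⟩ | ⟨rfl, rfl⟩
      · refine ⟨fun u hu => ?_, fun B hB => by simp at hB⟩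
        obtain rfl := Sum.inl.inj hu
        exact ih₂ B rfl _ hv (fun h => hp.1 (by rw [h]))
      · refine ⟨fun u hu => by simp at hu, fun B' hB u hu hua => ?_⟩
        obtain rfl := Sum.inr.inj hB
        have h := ih₁ v rfl
        exact not_separates_trans
          (B.2.not_separates hu hv hua (ne_left_of_not_separates h)) h

end Multigraph

/-- **Separation is detected by the brick-vertex tree.**  Let `G` be a finite
connected graph (loops and multiple edges allowed) and `a, b, c` three not
necessarily pairwise distinct vertices.  Then `a` separates `b` from `c` in `G` if
and only if `ā` separates `b̄` from `c̄` in the brick-vertex tree of `G`. -/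
theorem separates_iff_separates_bvt
    {V E : Type} [Fintype V] [Fintype E] (G : Multigraph V E)
    (hconn : G.Connected) (a b c : V) :
    G.Separates a b c ↔ (G.bvt).Separates (Sum.inl a) (Sum.inl b) (Sum.inl c) := by
  refine ⟨fun h => ?_, fun h => ?_⟩
  · by_contra hs
    obtain ⟨p, hp⟩ := Multigraph.not_separates_iff.1 hs
    exact (Multigraph.not_separates_of_bvt_walk p rfl hp).1 b rfl h
  · by_contra hs
    exact Multigraph.not_separates_bvt hs h
end
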